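/- For γ ∈ (1,2), there exists a constant C > 0 such that |g_j^{(γ)}| ≤ C · j^{−(γ+1)} for all j ≥ 1; that is, g_j^{(γ)} = O(j^{−(γ+1)}) as j → ∞. -/

import Mathlib

/-- Grünwald coefficient `g_j^(s) = ((-1)^j / j!) * s(s-1)⋯(s-j+1)` (with `g_0 = 1`). -/
noncomputable def grunwald (s : ℝ) (j : ℕ) : ℝ :=
  (-1) ^ j / (Nat.factorial j : ℝ) * ∏ i ∈ Finset.range j, (s - i)

theorem grunwald_succ (s : ℝ) (j : ℕ) :
    grunwald s (j + 1) = grunwald s j * ((j - s) / (j + 1)) := by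
  have h : (j : ℝ) + 1 ≠ 0 := by positivity
  have h' : (j.factorial : ℝ) ≠ 0 := by positivity
  simp only [grunwald, Finset.prod_range_succ, Nat.factorial_succ, pow_succ]
  push_cast
  field_simp
  ring

theorem abs_grunwald_succ_mul_rpow_le {s : ℝ} (hs : 0 ≤ s) {j : ℕ} (hj : s ≤ j) :
    |grunwald s (j + 1)| * ((j + 1 : ℕ) : ℝ) ^ (s + 1) ≤ |grunwald s j| * (j : ℝ) ^ (s + 1) := by
  have hpos : (0 : ℝ) < j + 1 := by positivity
  have hratio : (j - s) / (j + 1) ≤ (j : ℝ) ^ (s + 1) / (j + 1) ^ (s + 1) := by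
    have hneg : -1 ≤ -(1 / ((j : ℝ) + 1)) := by
      rw [neg_le_neg_iff, div_le_one hpos]
      linarith [Nat.cast_nonneg (α := ℝ) j]
    have hbern := one_add_mul_self_le_rpow_one_add hneg (le_add_of_nonneg_left hs)
    rw [← Real.div_rpow (Nat.cast_nonneg j) hpos.le]
    convert hbern using 1
    · field_simp
      ring
    · congr 1
      field_simp
      ring
  rw [grunwald_succ, abs_mul, abs_of_nonneg (div_nonneg (sub_nonneg.2 hj) hpos.le), mul_assoc,
    Nat.cast_succ]
  exact mul_le_mul_of_nonneg_left ((le_div_iff₀ (Real.rpow_pos_of_pos hpos _)).1 hratio)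
    (abs_nonneg _)

theorem exists_abs_grunwald_le {s : ℝ} (hs : 0 ≤ s) :
    ∃ C : ℝ, 0 < C ∧ ∀ j : ℕ, 1 ≤ j → |grunwald s j| ≤ C * (j : ℝ) ^ (-(s + 1)) := by
  have hnonneg (i : ℕ) : 0 ≤ |grunwald s i| * (i : ℝ) ^ (s + 1) := by positivity
  set C := 1 + ∑ i ∈ Finset.range (⌈s⌉₊ + 1), |grunwald s i| * (i : ℝ) ^ (s + 1) with hC
  have hsmall (j : ℕ) (hj : j ≤ ⌈s⌉₊) : |grunwald s j| * (j : ℝ) ^ (s + 1) ≤ C := by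
    have := Finset.single_le_sum (fun i _ => hnonneg i)
      (Finset.mem_range.2 (Nat.lt_succ_of_le hj))
    linarith
  have hbound (j : ℕ) : |grunwald s j| * (j : ℝ) ^ (s + 1) ≤ C := by
    induction j with
    | zero => exact hsmall 0 (Nat.zero_le _)
    | succ j ih =>
      rcases Nat.lt_or_ge j ⌈s⌉₊ with h | h
      · exact hsmall _ h
      · exact (abs_grunwald_succ_mul_rpow_le hs (Nat.ceil_le.1 h)).trans ih
  refine ⟨C, add_pos_of_pos_of_nonneg one_pos (Finset.sum_nonneg fun i _ => hnonneg i),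
    fun j hj => ?_⟩
  have hj' : (0 : ℝ) < j := by exact_mod_cast hj
  rw [Real.rpow_neg hj'.le, ← div_eq_mul_inv, le_div_iff₀ (Real.rpow_pos_of_pos hj' _)]
  exact hbound j

theorem stmt8 (γ : ℝ) (hγ : γ ∈ Set.Ioo (1 : ℝ) 2) :
    ∃ C : ℝ, 0 < C ∧ ∀ j : ℕ, 1 ≤ j → |grunwald γ j| ≤ C * (j : ℝ) ^ (-(γ + 1)) :=
  exists_abs_grunwald_le (zero_le_one.trans hγ.1.le)
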